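/- arXiv:1805.06929 — 2 statements merged into one kernel-verified Lean document; each statement's English description precedes it below -/
import Mathlib

section
/- Let α, ν, β > 0, κ ∈ (0,1) with κ(α/ν − 1) < 1, and let f be the κGG density. For a real number r, the function x ↦ x^r f(x) is integrable on (0,∞) if and only if −α < r < ν/κ + (ν − α); in particular, if r ≥ ν/κ + (ν − α) or r ≤ −α, the r-th moment of the κGG distribution does not exist. -/
open Real MeasureTheory Filter Set

/-- The κ-deformed exponential of Kaniadakis. -/
noncomputable def kexp (κ x : ℝ) : ℝ := (Real.sqrt (1 + κ^2 * x^2) + κ * x) ^ (1/κ)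

/-- The κ-deformed logarithm of Kaniadakis. -/
noncomputable def klog (κ x : ℝ) : ℝ := (x ^ κ - x ^ (-κ)) / (2*κ)

/-- The κ-deformed Gamma function (closed form in terms of the Euler Gamma function). -/
noncomputable def kGamma (κ z : ℝ) : ℝ :=
  ((1 - κ*(z-1)) / (2*κ) ^ (z-1)) *
    (Real.Gamma (1/(2*κ) - (z-1)/2) / Real.Gamma (1/(2*κ) + (z-1)/2)) * Real.Gamma z

/-- The κ-Generalized Gamma (κGG) density. -/
noncomputable def kGG (α ν β κ x : ℝ) : ℝ :=
  (1 - κ^2*(α/ν - 1)^2) * (ν/β) * (kGamma κ (α/ν))⁻¹ * (x/β) ^ (α-1) *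
    kexp κ (-((x/β) ^ ν)) / Real.sqrt (1 + κ^2 * (x/β) ^ (2*ν))

/-- The κ-Gamma function is positive on its natural domain. -/
lemma kGamma_pos {κ z : ℝ} (hκ : κ ∈ Set.Ioo (0:ℝ) 1) (hz : 0 < z) (h : κ * (z - 1) < 1) :
    0 < kGamma κ z := by
  obtain ⟨h0, h1⟩ := hκ
  have hinv : 1 < 1 / κ := by rw [lt_div_iff₀ h0]; linarith
  have hhalf : 1 / (2 * κ) = (1 / κ) / 2 := by field_simp
  have hz' : z - 1 < 1 / κ := by rw [lt_div_iff₀ h0]; linarith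
  have hΓ₁ : 0 < Real.Gamma (1 / (2 * κ) - (z - 1) / 2) :=
    Real.Gamma_pos_of_pos (by rw [hhalf]; linarith)
  have hΓ₂ : 0 < Real.Gamma (1 / (2 * κ) + (z - 1) / 2) :=
    Real.Gamma_pos_of_pos (by rw [hhalf]; linarith)
  have hΓ₃ := Real.Gamma_pos_of_pos hz
  have hnum : 0 < 1 - κ * (z - 1) := by linarith
  unfold kGamma
  positivity

lemma sqrt_add_pos (κ t : ℝ) : 0 < Real.sqrt (1 + κ ^ 2 * t ^ 2) + κ * t := by
  have hlt : |κ * t| < Real.sqrt (1 + κ ^ 2 * t ^ 2) := by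
    rw [← Real.sqrt_sq_eq_abs]
    exact Real.sqrt_lt_sqrt (sq_nonneg _) (by nlinarith)
  linarith [neg_abs_le (κ * t)]

lemma kexp_neg (κ t : ℝ) :
    kexp κ (-t) = (Real.sqrt (1 + κ ^ 2 * t ^ 2) + κ * t) ^ (-(1 / κ)) := by
  have hpos := sqrt_add_pos κ t
  have hinv : Real.sqrt (1 + κ ^ 2 * (-t) ^ 2) + κ * (-t) =
      (Real.sqrt (1 + κ ^ 2 * t ^ 2) + κ * t)⁻¹ := by
    refine eq_inv_of_mul_eq_one_left ?_
    rw [neg_sq]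
    nlinarith [Real.sq_sqrt (show 0 ≤ 1 + κ ^ 2 * t ^ 2 by positivity)]
  rw [kexp, hinv, Real.inv_rpow hpos.le, Real.rpow_neg hpos.le]

/-- Integrability transfers between nonnegative functions that bound each other up to constants. -/
lemma integrableOn_iff_of_mul_le_of_le_mul {s : Set ℝ} {f g : ℝ → ℝ} {c C : ℝ}
    (hs : MeasurableSet s) (hf : Measurable f) (hg : Measurable g) (hc : 0 < c)
    (hg0 : ∀ x ∈ s, 0 ≤ g x) (hl : ∀ x ∈ s, c * g x ≤ f x) (hu : ∀ x ∈ s, f x ≤ C * g x) :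
    IntegrableOn f s ↔ IntegrableOn g s := by
  constructor
  · intro hi
    refine Integrable.mono' (Integrable.const_mul hi c⁻¹) hg.aestronglyMeasurable ?_
    filter_upwards [ae_restrict_mem hs] with x hx
    rw [Real.norm_of_nonneg (hg0 x hx), le_inv_mul_iff₀ hc]
    exact hl x hx
  · intro hi
    refine Integrable.mono' (Integrable.const_mul hi C) hf.aestronglyMeasurable ?_
    filter_upwards [ae_restrict_mem hs] with x hx
    rw [Real.norm_of_nonneg ((mul_nonneg hc.le (hg0 x hx)).trans (hl x hx))]
    exact hu x hx

/-- If `√(1 + κ²t²)` lies between `a * m` and `2 * m`, with `t ≤ m`, then the κ-exponential kernel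
at `t` is comparable to `m ^ (-1/κ - 1)`. -/
lemma kexp_neg_div_sqrt_mem_Icc {κ t m a : ℝ} (hκ : κ ∈ Set.Ioo (0:ℝ) 1) (ht : 0 ≤ t)
    (ha : 0 < a) (hm : 0 < m) (hl : a * m ≤ Real.sqrt (1 + κ ^ 2 * t ^ 2))
    (hu : Real.sqrt (1 + κ ^ 2 * t ^ 2) ≤ 2 * m) (htm : t ≤ m) :
    kexp κ (-t) / Real.sqrt (1 + κ ^ 2 * t ^ 2) ∈
      Set.Icc (3 ^ (-(1 / κ)) / 2 * m ^ (-(1 / κ) - 1)) (a ^ (-(1 / κ)) / a * m ^ (-(1 / κ) - 1)) := by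
  obtain ⟨h0, h1⟩ := hκ
  have hκt : 0 ≤ κ * t := by positivity
  have hκtm : κ * t ≤ m := by nlinarith
  have hneg : -(1 / κ) ≤ 0 := by
    have : 0 < 1 / κ := by positivity
    linarith
  have hS : 0 < Real.sqrt (1 + κ ^ 2 * t ^ 2) := lt_of_lt_of_le (by positivity) hl
  rw [kexp_neg]
  constructor
  · calc 3 ^ (-(1 / κ)) / 2 * m ^ (-(1 / κ) - 1) = (3 * m) ^ (-(1 / κ)) / (2 * m) := by
          rw [Real.mul_rpow (by norm_num) hm.le, Real.rpow_sub_one hm.ne']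
          field_simp
      _ ≤ _ := div_le_div₀ (by positivity)
          (Real.rpow_le_rpow_of_nonpos (by positivity) (by linarith) hneg) hS hu
  · calc _ ≤ (a * m) ^ (-(1 / κ)) / (a * m) := div_le_div₀ (by positivity)
          (Real.rpow_le_rpow_of_nonpos (by positivity) (by linarith) hneg) (by positivity) hl
      _ = a ^ (-(1 / κ)) / a * m ^ (-(1 / κ) - 1) := by
          rw [Real.mul_rpow ha.le hm.le, Real.rpow_sub_one hm.ne']
          field_simp

lemma measurable_kexp (κ : ℝ) : Measurable (kexp κ) := by
  unfold kexp
  fun_prop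

/-- The Mellin-type integral of the κ-exponential kernel converges exactly on a strip. -/
lemma integrableOn_rpow_mul_kexp_iff {κ : ℝ} (s : ℝ) (hκ : κ ∈ Set.Ioo (0:ℝ) 1) :
    IntegrableOn (fun t : ℝ => t ^ (s - 1) * (kexp κ (-t) / Real.sqrt (1 + κ ^ 2 * t ^ 2)))
      (Set.Ioi 0) ↔ 0 < s ∧ s < 1 / κ + 1 := by
  have h0 := hκ.1
  have h1 := hκ.2
  have hmeas : Measurable
      (fun t : ℝ => t ^ (s - 1) * (kexp κ (-t) / Real.sqrt (1 + κ ^ 2 * t ^ 2))) := by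
    have := measurable_kexp κ
    fun_prop
  have hc : (0 : ℝ) < 3 ^ (-(1 / κ)) / 2 := by positivity
  have hsmall : IntegrableOn
      (fun t : ℝ => t ^ (s - 1) * (kexp κ (-t) / Real.sqrt (1 + κ ^ 2 * t ^ 2))) (Set.Ioo 0 1) ↔
      0 < s := by
    have hbound : ∀ t ∈ Set.Ioo (0 : ℝ) 1, _ := fun t (ht : t ∈ Set.Ioo (0 : ℝ) 1) =>
      kexp_neg_div_sqrt_mem_Icc (t := t) (m := 1) (a := 1) hκ ht.1.le one_pos one_pos
        (by rw [Real.le_sqrt' (by norm_num)]; nlinarith [sq_nonneg (κ * t)])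
        (by
          rw [Real.sqrt_le_left (by norm_num)]
          nlinarith [mul_lt_one_of_nonneg_of_lt_one_left h0.le h1 ht.2.le,
            mul_pos h0 ht.1])
        ht.2.le
    rw [integrableOn_iff_of_mul_le_of_le_mul (g := fun t => t ^ (s - 1))
      (c := 3 ^ (-(1 / κ)) / 2) (C := 1) measurableSet_Ioo hmeas (by fun_prop) hc
      (fun t ht => Real.rpow_nonneg ht.1.le _) (fun t ht => ?_) (fun t ht => ?_),
      intervalIntegral.integrableOn_Ioo_rpow_iff one_pos]
    · constructor <;> intro <;> linarith
    · have := (hbound t ht).1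
      rw [Real.one_rpow, mul_one] at this
      rw [mul_comm]
      exact mul_le_mul_of_nonneg_left this (Real.rpow_nonneg ht.1.le _)
    · have := (hbound t ht).2
      simp only [Real.one_rpow, mul_one, div_one] at this
      rw [mul_comm]
      exact mul_le_mul_of_nonneg_right this (Real.rpow_nonneg ht.1.le _)
  have hlarge : IntegrableOn
      (fun t : ℝ => t ^ (s - 1) * (kexp κ (-t) / Real.sqrt (1 + κ ^ 2 * t ^ 2))) (Set.Ioi 1) ↔
      s < 1 / κ + 1 := by
    have hbound : ∀ t ∈ Set.Ioi (1 : ℝ), _ := fun t (ht : 1 < t) =>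
      kexp_neg_div_sqrt_mem_Icc (t := t) (m := t) (a := κ) hκ (by linarith) h0 (by linarith)
        (by
          rw [Real.le_sqrt' (by positivity)]
          nlinarith)
        (by
          rw [Real.sqrt_le_left (by linarith)]
          have : κ ^ 2 * t ^ 2 ≤ 1 * t ^ 2 := by gcongr; nlinarith
          nlinarith)
        le_rfl
    have hpow : ∀ t ∈ Set.Ioi (1 : ℝ),
        t ^ (s - 1 + (-(1 / κ) - 1)) = t ^ (s - 1) * t ^ (-(1 / κ) - 1) := fun t ht =>
      Real.rpow_add (one_pos.trans ht) _ _
    have hnn : ∀ t ∈ Set.Ioi (1 : ℝ), 0 ≤ t ^ (s - 1) := fun t ht =>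
      Real.rpow_nonneg (one_pos.trans ht).le _
    rw [integrableOn_iff_of_mul_le_of_le_mul (g := fun t => t ^ (s - 1 + (-(1 / κ) - 1)))
      (c := 3 ^ (-(1 / κ)) / 2) (C := κ ^ (-(1 / κ)) / κ) measurableSet_Ioi hmeas (by fun_prop) hc
      (fun t ht => Real.rpow_nonneg (one_pos.trans ht).le _) (fun t ht => ?_) (fun t ht => ?_),
      integrableOn_Ioi_rpow_iff one_pos]
    · constructor <;> intro <;> linarith
    · rw [hpow t ht, mul_left_comm]
      exact mul_le_mul_of_nonneg_left (hbound t ht).1 (hnn t ht)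
    · rw [hpow t ht, mul_left_comm]
      exact mul_le_mul_of_nonneg_left (hbound t ht).2 (hnn t ht)
  rw [← Set.Ioc_union_Ioi_eq_Ioi (zero_le_one' ℝ), integrableOn_union,
    integrableOn_Ioc_iff_integrableOn_Ioo, hsmall, hlarge]

/-- Existence criterion for the moments of the κGG distribution. -/
theorem kGG_moment_exists_iff (α ν β κ r : ℝ) (hα : 0 < α) (hν : 0 < ν) (hβ : 0 < β)
    (hκ : κ ∈ Set.Ioo (0:ℝ) 1) (h : κ * (α/ν - 1) < 1) :
    MeasureTheory.IntegrableOn (fun x : ℝ => x ^ r * kGG α ν β κ x) (Set.Ioi 0) ↔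
      (-α < r ∧ r < ν/κ + (ν - α)) := by
  have h0 := hκ.1
  have h1 := hκ.2
  have hz : 0 < α / ν := by positivity
  have hC : (1 - κ ^ 2 * (α / ν - 1) ^ 2) * (ν / β) * (kGamma κ (α / ν))⁻¹ * β ^ r ≠ 0 := by
    have hΓ := kGamma_pos hκ hz h
    have hlow : -1 < κ * (α / ν - 1) := by nlinarith [mul_pos h0 hz]
    have hfac : 0 < 1 - κ ^ 2 * (α / ν - 1) ^ 2 := by
      nlinarith [mul_pos (sub_pos.2 h) (by linarith : 0 < 1 + κ * (α / ν - 1))]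
    positivity
  have hscale := integrableOn_Ioi_comp_mul_left_iff (fun x : ℝ => x ^ r * kGG α ν β κ x) 0 hβ
  rw [mul_zero] at hscale
  rw [← hscale]
  have hsub : Set.EqOn (fun x : ℝ => (β * x) ^ r * kGG α ν β κ (β * x))
      (fun x => ((1 - κ ^ 2 * (α / ν - 1) ^ 2) * (ν / β) * (kGamma κ (α / ν))⁻¹ * β ^ r) *
        (x ^ (ν - 1) • ((x ^ ν) ^ ((r + α) / ν - 1) *
          (kexp κ (-(x ^ ν)) / Real.sqrt (1 + κ ^ 2 * (x ^ ν) ^ 2))))) (Set.Ioi 0) := by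
    intro x (hx : 0 < x)
    have hdouble : x ^ (2 * ν) = (x ^ ν) ^ 2 := by
      rw [mul_comm, Real.rpow_mul hx.le, Real.rpow_two]
    have hpow : x ^ (ν - 1) * (x ^ ν) ^ ((r + α) / ν - 1) = x ^ r * x ^ (α - 1) := by
      rw [← Real.rpow_mul hx.le, ← Real.rpow_add hx, ← Real.rpow_add hx]
      congr 1
      field_simp
      ring
    simp only [kGG, mul_div_cancel_left₀ x hβ.ne', hdouble, Real.mul_rpow hβ.le hx.le, smul_eq_mul]
    rw [← mul_assoc (x ^ (ν - 1)), hpow]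
    ring
  rw [integrableOn_congr_fun hsub measurableSet_Ioi, IntegrableOn,
    integrable_const_mul_iff (isUnit_iff_ne_zero.2 hC), ← IntegrableOn,
    integrableOn_Ioi_comp_rpow_iff' (fun t : ℝ => t ^ ((r + α) / ν - 1) *
      (kexp κ (-t) / Real.sqrt (1 + κ ^ 2 * t ^ 2))) hν.ne',
    integrableOn_rpow_mul_kexp_iff _ hκ]
  refine and_congr ?_ ?_
  · rw [div_pos_iff_of_pos_right hν]
    constructor <;> intro <;> linarith
  · rw [div_lt_iff₀ hν, add_mul, one_mul, one_div_mul_eq_div]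
    constructor <;> intro <;> linarith
end

section
/- Let α, ν, β > 0, κ ∈ (0,1) with κ(α/ν − 1) < 1, and let f be the κGG density. Then ∫₀^∞ ln(x)·f(x) dx = ln β − (1/ν)·[ −ψ(α/ν) + (1/2)ψ(1/(2κ) − (α−ν)/(2ν)) + (1/2)ψ(1/(2κ) + (α−ν)/(2ν)) + ln(2κ) + κν/(ν + κ(α−ν)) ], where ψ(z) = Γ'(z)/Γ(z) is the digamma function. -/
open Real MeasureTheory Filter Set

/-- The digamma function ψ = Γ'/Γ. -/
noncomputable def digamma (z : ℝ) : ℝ := deriv Real.Gamma z / Real.Gamma z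

theorem integral_rpow_mul_one_sub_rpow {u v : ℝ} (hu : 0 < u) (hv : 0 < v) :
    ∫ x in Ioo (0 : ℝ) 1, x ^ (u - 1) * (1 - x) ^ (v - 1) = ProbabilityTheory.beta u v := by
  rw [ProbabilityTheory.beta_eq_betaIntegralReal u v hu hv, Complex.betaIntegral,
    intervalIntegral.integral_of_le zero_le_one, ← integral_Ioc_eq_integral_Ioo,
    ← RCLike.re_to_complex, ← integral_re]
  · refine setIntegral_congr_fun measurableSet_Ioc fun x ⟨hx1, hx2⟩ ↦ ?_
    norm_cast
    rw [← Complex.ofReal_cpow hx1.le, ← Complex.ofReal_cpow (by linarith), RCLike.re_to_complex,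
      Complex.re_mul_ofReal, Complex.ofReal_re]
  · have := Complex.betaIntegral_convergent (u := u) (v := v) (by simpa) (by simpa)
    rwa [intervalIntegrable_iff_integrableOn_Ioc_of_le zero_le_one] at this

/-- The profile of the κGG density without its power factor. -/
noncomputable def kProfile (κ t : ℝ) : ℝ := kexp κ (-t) / √(1 + κ ^ 2 * t ^ 2)

/-- The real Mellin transform of `kProfile`. -/
noncomputable def kMellin (κ z : ℝ) : ℝ := ∫ t in Ioi (0 : ℝ), t ^ (z - 1) * kProfile κ t

/-- The parametrization of `(0, ∞)` by `(0, 1)` inverse to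
`t ↦ (√(1 + κ² t²) - κ t) ^ 2`. -/
noncomputable def kSubst (κ s : ℝ) : ℝ := (1 - s) / (2 * κ * √s)

section

variable {κ : ℝ}

theorem sqrt_sub_pos (κ t : ℝ) : 0 < √(1 + κ ^ 2 * t ^ 2) - κ * t := by
  have : κ * t < √(1 + κ ^ 2 * t ^ 2) := Real.lt_sqrt_of_sq_lt (by nlinarith)
  linarith

theorem sqrt_sub_mul_sqrt_add (κ t : ℝ) :
    (√(1 + κ ^ 2 * t ^ 2) - κ * t) * (√(1 + κ ^ 2 * t ^ 2) + κ * t) = 1 := by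
  have := Real.sq_sqrt (show 0 ≤ 1 + κ ^ 2 * t ^ 2 by positivity)
  linear_combination this

theorem kProfile_eq (κ t : ℝ) :
    kProfile κ t = (√(1 + κ ^ 2 * t ^ 2) - κ * t) ^ (1 / κ) / √(1 + κ ^ 2 * t ^ 2) := by
  simp [kProfile, kexp, sub_eq_add_neg]

theorem kProfile_nonneg (κ t : ℝ) : 0 ≤ kProfile κ t := by
  rw [kProfile_eq]
  have := (sqrt_sub_pos κ t).le
  positivity

theorem continuous_kProfile (κ : ℝ) : Continuous (kProfile κ) := by
  rw [funext (kProfile_eq κ)]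
  refine Continuous.div (Continuous.rpow_const (by fun_prop) fun t ↦ Or.inl (sqrt_sub_pos κ t).ne')
    (by fun_prop) fun t ↦ ?_
  positivity

theorem kProfile_le_one (hκ : 0 < κ) {t : ℝ} (ht : 0 ≤ t) : kProfile κ t ≤ 1 := by
  have h0 := sqrt_sub_pos κ t
  have h1 : 1 ≤ √(1 + κ ^ 2 * t ^ 2) := by
    rw [Real.one_le_sqrt]; nlinarith [mul_nonneg (sq_nonneg κ) (sq_nonneg t)]
  have hκt : 0 ≤ κ * t := by positivity
  have h2 : √(1 + κ ^ 2 * t ^ 2) - κ * t ≤ 1 := by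
    nlinarith [sqrt_sub_mul_sqrt_add κ t]
  rw [kProfile_eq, div_le_one (by positivity)]
  exact (Real.rpow_le_one h0.le h2 (by positivity)).trans h1

theorem kProfile_le_rpow (hκ : 0 < κ) {t : ℝ} (ht : 0 < t) :
    kProfile κ t ≤ κ ^ (-(1 / κ + 1)) * t ^ (-(1 / κ + 1)) := by
  have h0 := sqrt_sub_pos κ t
  have hκt : 0 < κ * t := by positivity
  have h1 : κ * t ≤ √(1 + κ ^ 2 * t ^ 2) := by linarith
  have h2 : √(1 + κ ^ 2 * t ^ 2) - κ * t ≤ (κ * t)⁻¹ := by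
    rw [← one_div, le_div_iff₀ hκt]
    nlinarith [sqrt_sub_mul_sqrt_add κ t]
  rw [kProfile_eq, ← Real.mul_rpow hκ.le ht.le, neg_add, Real.rpow_add hκt, Real.rpow_neg_one,
    ← div_eq_mul_inv, Real.rpow_neg hκt.le, ← Real.inv_rpow hκt.le]
  gcongr

open Topology Asymptotics in
theorem hasDerivAt_mellin_kProfile (hκ : 0 < κ) {z : ℝ} (hz : 0 < z) (hz' : z < 1 / κ + 1) :
    MellinConvergent (fun t ↦ Real.log t • (kProfile κ t : ℂ)) z ∧
      HasDerivAt (mellin fun t ↦ (kProfile κ t : ℂ))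
        (mellin (fun t ↦ Real.log t • (kProfile κ t : ℂ)) z) z := by
  refine mellin_hasDerivAt_of_isBigO_rpow (a := 1 / κ + 1) (b := 0) ?_ ?_ (by simpa using hz') ?_
    (by simpa using hz)
  · exact (Complex.continuous_ofReal.comp (continuous_kProfile κ)).continuousOn
      |>.locallyIntegrableOn measurableSet_Ioi
  · refine IsBigO.of_bound (κ ^ (-(1 / κ + 1))) ?_
    filter_upwards [eventually_gt_atTop 0] with t ht
    rw [Complex.norm_real, Real.norm_of_nonneg (kProfile_nonneg κ t),
      Real.norm_of_nonneg (by positivity)]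
    exact kProfile_le_rpow hκ ht
  · refine IsBigO.of_bound 1 ?_
    filter_upwards [self_mem_nhdsWithin] with t ht
    rw [Complex.norm_real, Real.norm_of_nonneg (kProfile_nonneg κ t)]
    simpa using kProfile_le_one hκ (le_of_lt ht)

theorem mellin_ofReal (f : ℝ → ℝ) (z : ℝ) :
    mellin (fun t ↦ (f t : ℂ)) z = ((∫ t in Ioi (0 : ℝ), t ^ (z - 1) * f t : ℝ) : ℂ) := by
  rw [mellin, ← integral_complex_ofReal]
  refine setIntegral_congr_fun measurableSet_Ioi fun t ht ↦ ?_
  simp [Complex.ofReal_cpow (le_of_lt ht)]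

theorem MellinConvergent.integrableOn_ofReal {f : ℝ → ℝ} {z : ℝ}
    (h : MellinConvergent (fun t ↦ (f t : ℂ)) z) :
    IntegrableOn (fun t ↦ t ^ (z - 1) * f t) (Ioi 0) := by
  refine (integrableOn_congr_fun (fun t ht ↦ ?_) measurableSet_Ioi).mp h.re
  simp only [RCLike.re_to_complex, smul_eq_mul, Complex.re_mul_ofReal]
  rw [← Complex.ofReal_one, ← Complex.ofReal_sub, ← Complex.ofReal_cpow (le_of_lt ht),
    Complex.ofReal_re]

theorem hasDerivAt_kMellin (hκ : 0 < κ) {z : ℝ} (hz : 0 < z) (hz' : z < 1 / κ + 1) :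
    IntegrableOn (fun t ↦ t ^ (z - 1) * (Real.log t * kProfile κ t)) (Ioi 0) ∧
      HasDerivAt (kMellin κ) (∫ t in Ioi (0 : ℝ), t ^ (z - 1) * (Real.log t * kProfile κ t)) z := by
  obtain ⟨h1, h2⟩ := hasDerivAt_mellin_kProfile hκ hz hz'
  have e : (fun t ↦ Real.log t • (kProfile κ t : ℂ)) =
      fun t ↦ ((Real.log t * kProfile κ t : ℝ) : ℂ) := by
    ext t; simp
  rw [e] at h1 h2
  refine ⟨h1.integrableOn_ofReal, ?_⟩
  have h3 := h2.real_of_complex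
  simp only [mellin_ofReal, Complex.ofReal_re] at h3
  exact h3

theorem kSubst_image (hκ : 0 < κ) : kSubst κ '' Ioo 0 1 = Ioi 0 := by
  ext t
  constructor
  · rintro ⟨s, ⟨h0, h1⟩, rfl⟩
    have : 0 < 1 - s := by linarith
    have := Real.sqrt_pos.mpr h0
    simp only [mem_Ioi, kSubst]
    positivity
  · intro ht
    have ht : 0 < t := ht
    have h0 := sqrt_sub_pos κ t
    have hκt : 0 < κ * t := by positivity
    have h := sqrt_sub_mul_sqrt_add κ t
    set w := √(1 + κ ^ 2 * t ^ 2) - κ * t with hw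
    have h' : w * (w + 2 * (κ * t)) = 1 := by rw [← h]; ring
    refine ⟨w ^ 2, ⟨by positivity, by nlinarith⟩, ?_⟩
    rw [kSubst, Real.sqrt_sq h0.le, div_eq_iff (by positivity)]
    linear_combination -h'

theorem kSubst_strictAntiOn (hκ : 0 < κ) : StrictAntiOn (kSubst κ) (Ioo 0 1) := by
  intro a ha b hb hab
  have := Real.sqrt_pos.mpr ha.1
  have := Real.sqrt_lt_sqrt ha.1.le hab
  have : 0 ≤ 1 - a := by linarith [ha.2]
  simp only [kSubst]
  gcongr

theorem hasDerivAt_kSubst (hκ : 0 < κ) {s : ℝ} (hs : 0 < s) :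
    HasDerivAt (kSubst κ) (-((1 + s) / (4 * κ * s * √s))) s := by
  have hq := Real.sqrt_pos.mpr hs
  have h := ((hasDerivAt_id s).const_sub 1).div ((Real.hasDerivAt_sqrt hs.ne').const_mul (2 * κ))
    (by positivity)
  refine h.congr_deriv ?_
  obtain ⟨w, hw, rfl⟩ : ∃ w, 0 < w ∧ s = w ^ 2 := ⟨√s, hq, (Real.sq_sqrt hs.le).symm⟩
  rw [id, Real.sqrt_sq hw.le]
  field_simp
  ring

theorem kProfile_kSubst (hκ : 0 < κ) {s : ℝ} (hs : 0 < s) :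
    kProfile κ (kSubst κ s) = s ^ (1 / (2 * κ)) * (2 * √s / (1 + s)) := by
  obtain ⟨w, hw, rfl⟩ : ∃ w, 0 < w ∧ s = w ^ 2 :=
    ⟨√s, Real.sqrt_pos.mpr hs, (Real.sq_sqrt hs.le).symm⟩
  have h : √(1 + κ ^ 2 * kSubst κ (w ^ 2) ^ 2) = (1 + w ^ 2) / (2 * w) := by
    rw [Real.sqrt_eq_iff_mul_self_eq_of_pos (by positivity), kSubst, Real.sqrt_sq hw.le]
    field_simp
    ring
  have h' : (1 + w ^ 2) / (2 * w) - κ * kSubst κ (w ^ 2) = w := by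
    rw [kSubst, Real.sqrt_sq hw.le]
    field_simp
    ring
  rw [kProfile_eq, h, h', Real.sqrt_sq hw.le, ← Real.rpow_natCast w 2, ← Real.rpow_mul hw.le,
    Real.rpow_natCast]
  rw [show ((2 : ℕ) : ℝ) * (1 / (2 * κ)) = 1 / κ by push_cast; field_simp]
  field_simp

theorem kMellin_eq (hκ : 0 < κ) {z : ℝ} (hz : 0 < z) (hz' : z < 1 / κ + 1) :
    kMellin κ z = (2 * κ) ^ (-z) * ProbabilityTheory.beta (1 / (2 * κ) - (z - 1) / 2) z := by
  have hu : 0 < 1 / (2 * κ) - (z - 1) / 2 := by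
    have : 1 / (2 * κ) = 1 / κ / 2 := by field_simp
    linarith
  rw [← integral_rpow_mul_one_sub_rpow hu hz, kMellin, ← kSubst_image hκ,
    integral_image_eq_integral_abs_deriv_smul measurableSet_Ioo
      (fun s hs ↦ (hasDerivAt_kSubst hκ hs.1).hasDerivWithinAt) (kSubst_strictAntiOn hκ).injOn,
    ← integral_const_mul]
  refine setIntegral_congr_fun measurableSet_Ioo fun s ⟨h0, h1⟩ ↦ ?_
  have h1' : 0 < 1 - s := by linarith
  have hq := Real.sqrt_pos.mpr h0
  simp only [smul_eq_mul]
  rw [abs_neg, abs_of_pos (by positivity), kProfile_kSubst hκ h0, kSubst,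
    Real.div_rpow h1'.le (by positivity), Real.mul_rpow (by positivity) hq.le,
    Real.sqrt_eq_rpow, ← Real.rpow_mul h0.le,
    show 1 / (2 * κ) - (z - 1) / 2 - 1 = 1 / (2 * κ) - 1 / 2 * (z - 1) - 1 by ring,
    Real.rpow_sub h0, Real.rpow_sub h0, Real.rpow_one, Real.rpow_neg (by positivity)]
  have e : (κ * 2) ^ z = (κ * 2) ^ (z - 1) * (κ * 2) := by
    rw [← Real.rpow_add_one (by positivity), sub_add_cancel]
  field_simp
  linear_combination 2 * e

theorem hasDerivAt_Gamma_digamma {z : ℝ} (hz : 0 < z) :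
    HasDerivAt Real.Gamma (Real.Gamma z * digamma z) z := by
  rw [digamma, mul_div_cancel₀ _ (Real.Gamma_pos_of_pos hz).ne']
  exact (Real.differentiableAt_Gamma fun m ↦ by
    have : (0 : ℝ) ≤ m := m.cast_nonneg
    linarith).hasDerivAt

theorem digamma_add_one {z : ℝ} (hz : 0 < z) : digamma (z + 1) = digamma z + 1 / z := by
  have hG := Real.Gamma_pos_of_pos hz
  have h1 := (hasDerivAt_Gamma_digamma (add_pos hz one_pos)).comp_add_const z 1
  have h2 := (hasDerivAt_id z).mul (hasDerivAt_Gamma_digamma hz)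
  have h3 : (fun x : ℝ ↦ Real.Gamma (x + 1)) =ᶠ[nhds z] id * Real.Gamma := by
    filter_upwards [lt_mem_nhds hz] with x hx using Real.Gamma_add_one hx.ne'
  have h4 := h1.unique (h2.congr_of_eventuallyEq h3)
  rw [Real.Gamma_add_one hz.ne', id] at h4
  field_simp
  field_simp at h4
  linarith

theorem logDeriv_kMellin (hκ : 0 < κ) {z : ℝ} (hz : 0 < z) (hz' : z < 1 / κ + 1) :
    HasDerivAt (kMellin κ) (kMellin κ z * (-Real.log (2 * κ) + digamma z
      - 1 / 2 * digamma (1 / (2 * κ) - (z - 1) / 2)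
      - 1 / 2 * digamma (1 / (2 * κ) - (z - 1) / 2 + z))) z := by
  have hu : 0 < 1 / (2 * κ) - (z - 1) / 2 := by
    have : 1 / (2 * κ) = 1 / κ / 2 := by field_simp
    linarith
  have hv := add_pos hu hz
  have e : kMellin κ =ᶠ[nhds z] fun z ↦
      (2 * κ) ^ (-z) * ProbabilityTheory.beta (1 / (2 * κ) - (z - 1) / 2) z := by
    filter_upwards [lt_mem_nhds hz, gt_mem_nhds hz'] with y hy hy' using kMellin_eq hκ hy hy'
  have hlin : HasDerivAt (fun z : ℝ ↦ 1 / (2 * κ) - (z - 1) / 2) (-(1 / 2)) z :=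
    (((hasDerivAt_id z).sub_const 1).div_const 2).const_sub _
  have d1 := ((hasDerivAt_id z).neg).const_rpow (show 0 < 2 * κ by positivity)
  have d2 := (hasDerivAt_Gamma_digamma hu).comp z hlin
  have d3 := HasDerivAt.comp (h := fun z : ℝ ↦ 1 / (2 * κ) - (z - 1) / 2 + z) z
    (hasDerivAt_Gamma_digamma hv) (hlin.add (hasDerivAt_id z))
  have d := d1.mul ((d2.mul (hasDerivAt_Gamma_digamma hz)).div d3 (Real.Gamma_pos_of_pos hv).ne')
  refine HasDerivAt.congr_of_eventuallyEq (HasDerivAt.congr_deriv d ?_) e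
  have := (Real.Gamma_pos_of_pos hv).ne'
  rw [kMellin_eq hκ hz hz', ProbabilityTheory.beta]
  simp only [Function.comp, Pi.mul_apply, Pi.div_apply, Pi.neg_apply, id]
  field_simp
  ring

theorem kGamma_eq (hκ : κ ∈ Ioo (0 : ℝ) 1) {z : ℝ} (hz : 0 < z) (hz' : z < 1 / κ + 1) :
    kGamma κ z = (1 - κ ^ 2 * (z - 1) ^ 2) * kMellin κ z := by
  obtain ⟨hκ, hκ1⟩ := hκ
  have hw : 0 < 1 + κ * (z - 1) := by nlinarith
  have hv : 0 < 1 / (2 * κ) + (z - 1) / 2 := by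
    have : 1 / (2 * κ) + (z - 1) / 2 = (1 + κ * (z - 1)) / (2 * κ) := by field_simp
    rw [this]; positivity
  have hG := (Real.Gamma_pos_of_pos hv).ne'
  rw [kGamma, kMellin_eq hκ hz hz', ProbabilityTheory.beta,
    show 1 / (2 * κ) - (z - 1) / 2 + z = 1 / (2 * κ) + (z - 1) / 2 + 1 by ring,
    Real.Gamma_add_one hv.ne', Real.rpow_neg (by positivity),
    show 1 / (2 * κ) + (z - 1) / 2 = (1 + κ * (z - 1)) / (2 * κ) by field_simp,
    Real.rpow_sub_one (by positivity) z] at *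
  field_simp
  ring

theorem kMellin_pos (hκ : 0 < κ) {z : ℝ} (hz : 0 < z) (hz' : z < 1 / κ + 1) :
    0 < kMellin κ z := by
  have hu : 0 < 1 / (2 * κ) - (z - 1) / 2 := by
    have : 1 / (2 * κ) = 1 / κ / 2 := by field_simp
    linarith
  rw [kMellin_eq hκ hz hz']
  have := ProbabilityTheory.beta_pos hu hz
  positivity

/-- A κGG-weighted integral written in the variable `t = (x / β) ^ ν`. -/
theorem integral_mul_kGG {α ν β : ℝ} (hν : 0 < ν) (hβ : 0 < β) (κ : ℝ) (g : ℝ → ℝ) :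
    ∫ x in Ioi (0 : ℝ), g x * kGG α ν β κ x =
      (1 - κ ^ 2 * (α / ν - 1) ^ 2) * (kGamma κ (α / ν))⁻¹ *
        ∫ t in Ioi (0 : ℝ), g (β * t ^ (1 / ν)) * (t ^ (α / ν - 1) * kProfile κ t) := by
  have := integral_comp_mul_left_Ioi' (fun x ↦ g x * kGG α ν β κ x) 0 hβ
  rw [mul_zero] at this
  rw [← this, smul_eq_mul, ← integral_const_mul,
    ← integral_comp_rpow_Ioi_of_pos (g := fun t ↦ g (β * t ^ (1 / ν)) * _) hν,
    ← integral_const_mul]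
  refine setIntegral_congr_fun measurableSet_Ioi fun y hy ↦ ?_
  have hy : 0 < y := hy
  simp only [smul_eq_mul, kGG, kProfile]
  rw [mul_div_cancel_left₀ y hβ.ne', ← Real.rpow_mul hy.le, ← Real.rpow_mul hy.le,
    mul_one_div_cancel hν.ne', Real.rpow_one, mul_comm 2 ν, Real.rpow_mul hy.le ν 2,
    Real.rpow_two, show α - 1 = (ν - 1) + ν * (α / ν - 1) by field_simp; ring,
    Real.rpow_add hy]
  field_simp

end

/-- Mean of the logarithm under the κGG distribution. -/
theorem kGG_log_mean (α ν β κ : ℝ) (hα : 0 < α) (hν : 0 < ν) (hβ : 0 < β)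
    (hκ : κ ∈ Set.Ioo (0:ℝ) 1) (h : κ * (α/ν - 1) < 1) :
    ∫ x in Set.Ioi (0:ℝ), Real.log x * kGG α ν β κ x =
      Real.log β - (1/ν) *
        ( -digamma (α/ν) + (1/2) * digamma (1/(2*κ) - (α-ν)/(2*ν))
          + (1/2) * digamma (1/(2*κ) + (α-ν)/(2*ν))
          + Real.log (2*κ) + κ*ν/(ν + κ*(α-ν)) ) := by
  obtain ⟨hκ0, hκ1⟩ := hκ
  have hz : 0 < α / ν := by positivity
  have hz' : α / ν < 1 / κ + 1 := by
    have : α / ν - 1 < 1 / κ := by rw [lt_div_iff₀ hκ0]; linarith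
    linarith
  obtain ⟨hL, hD⟩ := hasDerivAt_kMellin hκ0 hz hz'
  have hM := kMellin_pos hκ0 hz hz'
  have hI : IntegrableOn (fun t ↦ t ^ (α / ν - 1) * kProfile κ t) (Ioi 0) := by
    by_contra hc
    exact hM.ne' (integral_undef hc)
  have hlow : 0 < 1 + κ * (α / ν - 1) := by nlinarith
  have hup : 0 < 1 - κ * (α / ν - 1) := by linarith
  have hC : 1 - κ ^ 2 * (α / ν - 1) ^ 2 ≠ 0 := by
    have := mul_pos hlow hup
    nlinarith
  have hlog : ∫ t in Ioi (0 : ℝ), Real.log (β * t ^ (1 / ν)) * (t ^ (α / ν - 1) * kProfile κ t) =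
      Real.log β * kMellin κ (α / ν) +
        1 / ν * ∫ t in Ioi (0 : ℝ), t ^ (α / ν - 1) * (Real.log t * kProfile κ t) := by
    rw [kMellin, ← integral_const_mul, ← integral_const_mul,
      ← integral_add (hI.const_mul _) (hL.const_mul _)]
    refine setIntegral_congr_fun measurableSet_Ioi fun t ht ↦ ?_
    have ht : 0 < t := ht
    rw [Real.log_mul hβ.ne' (by positivity), Real.log_rpow ht]
    ring
  have hv : 0 < 1 / (2 * κ) + (α / ν - 1) / 2 := by
    rw [show 1 / (2 * κ) + (α / ν - 1) / 2 = (1 + κ * (α / ν - 1)) / (2 * κ) by field_simp]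
    positivity
  have hw : 0 < ν + κ * (α - ν) := by
    rw [show ν + κ * (α - ν) = ν * (1 + κ * (α / ν - 1)) by field_simp]
    positivity
  have hfrac : 1 / (1 / (2 * κ) + (α / ν - 1) / 2) = 2 * (κ * ν / (ν + κ * (α - ν))) := by
    rw [show 1 / (2 * κ) + (α / ν - 1) / 2 = (ν + κ * (α - ν)) / (2 * κ * ν) by field_simp]
    field_simp
  rw [integral_mul_kGG hν hβ, kGamma_eq ⟨hκ0, hκ1⟩ hz hz', hlog,
    hD.unique (logDeriv_kMellin hκ0 hz hz'),
    show 1 / (2 * κ) - (α / ν - 1) / 2 + α / ν = 1 / (2 * κ) + (α / ν - 1) / 2 + 1 by ring,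
    digamma_add_one hv, hfrac,
    show (α - ν) / (2 * ν) = (α / ν - 1) / 2 by field_simp, mul_inv, mul_inv_cancel_left₀ hC,
    mul_add, mul_left_comm _ (Real.log β), inv_mul_cancel₀ hM.ne', mul_left_comm _ (1 / ν),
    inv_mul_cancel_left₀ hM.ne']
  ring
end
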